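/- For a set S of non-pointed matrices (S ⊆ matr), the following are equivalent: (i) every finitely complete category with S-closed relations is a preorder; (ii) every finitely complete category with S-closed strong relations (i.e., every relation given by a strong monomorphism is M-closed for each M ∈ S) is a preorder. -/

import Mathlib

open CategoryTheory CategoryTheory.Limits

universe w v u

/-- A (non-pointed) extended matrix `M ∈ matr(n,m,k)`: `n > 0` rows, `m` left
columns and one right column, with entries in `{x₁, …, x_k}` (modelled as
`Fin k`). `matr` is the union over all `n,m,k`, i.e. the type `Matr`. -/
structure Matr where
  n : ℕ
  m : ℕ
  k : ℕ
  npos : 0 < n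
  left : Fin n → Fin m → Fin k
  right : Fin n → Fin k

namespace Matr

variable {C : Type u} [Category.{v} C]

/-- A relation `r : R ⟶ P`, where `pr` exhibits `P` as the `n`-fold product
`Xⁿ`, is `M`-closed: for every object `Z` and every interpretation
`f : {x₁,…,x_k} → C(Z,X)` of the entries of `M`, if for every left column `j`
the induced morphism `Z ⟶ Xⁿ` factors through `r`, then so does the morphism
induced by the right column. -/
def IsClosed (M : Matr) {X P R : C} (pr : Fin M.n → (P ⟶ X))
    (hP : IsLimit (Fan.mk P pr)) (r : R ⟶ P) : Prop :=
  ∀ (Z : C) (f : Fin M.k → (Z ⟶ X)),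
    (∀ j : Fin M.m, ∃ g : Z ⟶ R,
        g ≫ r = hP.lift (Fan.mk Z (fun i => f (M.left i j)))) →
    ∃ g : Z ⟶ R, g ≫ r = hP.lift (Fan.mk Z (fun i => f (M.right i)))

/-- A relation `r : R ⟶ P`, where `pr` exhibits `P` as the product
`X₁ × ⋯ × X_n` of a family `X : Fin n → C`, is strictly `M`-closed: for every
object `Z` and every row-wise interpretation `fᵢ : {x₁,…,x_k} → C(Z,Xᵢ)`, if
every left column's induced morphism `Z ⟶ X₁ × ⋯ × X_n` factors through `r`,
then so does the right column's induced morphism. -/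
def IsStrictClosed (M : Matr) {X : Fin M.n → C} {P R : C}
    (pr : ∀ i, P ⟶ X i) (hP : IsLimit (Fan.mk P pr)) (r : R ⟶ P) : Prop :=
  ∀ (Z : C) (f : ∀ i, Fin M.k → (Z ⟶ X i)),
    (∀ j : Fin M.m, ∃ g : Z ⟶ R,
        g ≫ r = hP.lift (Fan.mk Z (fun i => f i (M.left i j)))) →
    ∃ g : Z ⟶ R, g ≫ r = hP.lift (Fan.mk Z (fun i => f i (M.right i)))

/-- `C` has `M`-closed `W`-relations: every `n`-ary relation `r : R ⟶ Xⁿ`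
belonging to the class of monomorphisms `W` is `M`-closed. -/
def HasClosedRels (M : Matr) (C : Type u) [Category.{v} C]
    (W : MorphismProperty C) : Prop :=
  ∀ (X P R : C) (pr : Fin M.n → (P ⟶ X)) (hP : IsLimit (Fan.mk P pr))
    (r : R ⟶ P), W r → M.IsClosed pr hP r

/-- `C` has `S`-closed `W`-relations. -/
def HasSClosedRels (S : Set Matr) (C : Type u) [Category.{v} C]
    (W : MorphismProperty C) : Prop :=
  ∀ M ∈ S, HasClosedRels M C W

end Matr

/-- The class of strong monomorphisms of `C`, as a `MorphismProperty`. -/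
def strongMonos (C : Type u) [Category.{v} C] : MorphismProperty C :=
  fun _ _ f => StrongMono f

/-- No two instances of the rows of `M` in a two-element set agree on the left part while
disagreeing on the right part. -/
def Matr.Consistent (M : Matr) : Prop :=
  ∀ (i i' : Fin M.n) (f f' : Fin M.k → Bool),
    (∀ j, f (M.left i j) = f' (M.left i' j)) → f (M.right i) = f' (M.right i')

/-- An inconsistent matrix forces every category with closed strong relations to be a preorder. -/
theorem Matr.preorder_of_not_consistent (M : Matr) (hM : ¬ M.Consistent)
    (C : Type u) [Category.{v} C] [HasFiniteLimits C]
    (hC : M.HasClosedRels C (strongMonos C)) (X Y : C) : Subsingleton (X ⟶ Y) := by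
  constructor
  intro a b
  unfold Matr.Consistent at hM
  push Not at hM
  obtain ⟨i, i', f, f', hleft, hright⟩ := hM
  let val : Bool → (X ⟶ Y) := fun t => if t then a else b
  let T : C := Y ⨯ Y
  let P : C := ∏ᶜ (fun _ : Fin M.n => T)
  let pr : Fin M.n → (P ⟶ T) := fun l => Pi.π (fun _ : Fin M.n => T) l
  have hP : IsLimit (Fan.mk P pr) := productIsProduct (fun _ : Fin M.n => T)
  let p : P ⟶ Y := pr i ≫ prod.fst
  let q : P ⟶ Y := pr i' ≫ prod.snd
  have key := hC T P (equalizer p q) pr hP (equalizer.ι p q)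
    (show StrongMono (equalizer.ι p q) from inferInstance)
    X (fun x => prod.lift (val (f x)) (val (f' x)))
  have hfac : ∀ (g : Fin M.n → (X ⟶ T)) (l : Fin M.n),
      hP.lift (Fan.mk X g) ≫ pr l = g l := fun g l => hP.fac (Fan.mk X g) ⟨l⟩
  obtain ⟨g, hg⟩ := key (by
    intro j
    refine ⟨equalizer.lift (hP.lift (Fan.mk X _)) ?_, equalizer.lift_ι _ _⟩
    dsimp only [p, q]
    rw [← Category.assoc, ← Category.assoc, hfac, hfac, prod.lift_fst, prod.lift_snd, hleft j])
  have h1 : (g ≫ equalizer.ι p q) ≫ p = (g ≫ equalizer.ι p q) ≫ q := by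
    rw [Category.assoc, Category.assoc, equalizer.condition]
  rw [hg] at h1
  dsimp only [p, q] at h1
  rw [← Category.assoc, ← Category.assoc, hfac, hfac, prod.lift_fst, prod.lift_snd] at h1
  dsimp only [val] at h1
  cases h2 : f (M.right i) <;> cases h3 : f' (M.right i') <;> simp_all

/-- A consistent matrix gives closed relations in any category dual to a full category of sets
having a set with two elements. -/
theorem Matr.closed_of_consistent (M : Matr) (hM : M.Consistent)
    {D : Type u} [Category.{v} D] (V : D → Type)
    (φ : ∀ {A B : D}, (A ⟶ B) ≃ (V B → V A))
    (hφ : ∀ {A B E : D} (f : A ⟶ B) (g : B ⟶ E), φ (f ≫ g) = φ f ∘ φ g)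
    (b : D) (b₀ b₁ : V b) (hb : b₀ ≠ b₁) :
    M.HasClosedRels D (MorphismProperty.monomorphisms D) := by
  classical
  intro X P R pr hP r hr Z f hf
  have hmono : Mono r := hr
  -- `r` acts surjectively
  have hsurj : Function.Surjective (φ r) := by
    by_contra hcon
    unfold Function.Surjective at hcon
    push Not at hcon
    obtain ⟨y, hy⟩ := hcon
    have e : (φ.symm (fun z : V R => if z = y then b₀ else b₁) : b ⟶ R)
        = φ.symm (fun _ : V R => b₁) := by
      rw [← cancel_mono r]
      apply φ.injective
      rw [hφ, hφ, Equiv.apply_symm_apply, Equiv.apply_symm_apply]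
      funext x
      simp [hy x]
    have e' := congrFun (φ.symm.injective e) y
    simp only [if_true] at e'
    exact hb e'
  -- the projections act jointly surjectively
  have hjoint : ∀ p : V P, ∃ (i : Fin M.n) (x : V X), φ (pr i) x = p := by
    by_contra hcon
    push Not at hcon
    obtain ⟨y, hy⟩ := hcon
    have e : (φ.symm (fun z : V P => if z = y then b₀ else b₁) : b ⟶ P)
        = φ.symm (fun _ : V P => b₁) := by
      refine Fan.IsLimit.hom_ext hP _ _ (fun i => ?_)
      change _ ≫ pr i = _ ≫ pr i
      apply φ.injective
      rw [hφ, hφ, Equiv.apply_symm_apply, Equiv.apply_symm_apply]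
      funext x
      simp [hy i x]
    have e' := congrFun (φ.symm.injective e) y
    simp only [if_true] at e'
    exact hb e'
  have hfac : ∀ (g : Fin M.n → (Z ⟶ X)) (l : Fin M.n) (x : V X),
      φ (hP.lift (Fan.mk Z g)) (φ (pr l) x) = φ (g l) x := by
    intro g l x
    have h : hP.lift (Fan.mk Z g) ≫ pr l = g l := hP.fac (Fan.mk Z g) ⟨l⟩
    rw [← h, hφ]
    rfl
  have hwd : ∀ p p' : V P, φ r p = φ r p' →
      φ (hP.lift (Fan.mk Z (fun i => f (M.right i)))) p
        = φ (hP.lift (Fan.mk Z (fun i => f (M.right i)))) p' := by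
    intro p p' hpp
    obtain ⟨i, x, rfl⟩ := hjoint p
    obtain ⟨i', x', rfl⟩ := hjoint p'
    rw [hfac, hfac]
    have hl : ∀ j, φ (f (M.left i j)) x = φ (f (M.left i' j)) x' := by
      intro j
      obtain ⟨g, hg⟩ := hf j
      rw [← hfac (fun i => f (M.left i j)) i x, ← hfac (fun i => f (M.left i j)) i' x', ← hg, hφ]
      simp only [Function.comp_apply, hpp]
    have := hM i i' (fun c => decide (φ (f c) x = φ (f (M.right i)) x))
      (fun c => decide (φ (f c) x' = φ (f (M.right i)) x)) (fun j => by rw [hl j])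
    simp only [decide_true] at this
    exact (of_decide_eq_true this.symm).symm
  refine ⟨φ.symm (fun y => φ (hP.lift (Fan.mk Z (fun i => f (M.right i))))
    (Function.surjInv hsurj y)), ?_⟩
  apply φ.injective
  rw [hφ, Equiv.apply_symm_apply]
  funext p
  exact hwd _ _ (Function.surjInv_eq hsurj _)

/-- Objects of the dual of the category of finite cardinals, in a prescribed universe. -/
structure FinDual : Type u where
  n : ℕ

namespace FinDual

/-- Morphisms are functions in the opposite direction. -/
instance cat : Category.{v} FinDual.{u} where
  Hom A B := ULift.{v} (Fin B.n → Fin A.n)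
  id _ := ⟨id⟩
  comp f g := ⟨f.down ∘ g.down⟩

/-- The morphisms of `FinDual` are functions in the opposite direction. -/
def homFun {A B : FinDual.{u}} : (A ⟶ B) ≃ (Fin B.n → Fin A.n) := Equiv.ulift.{v}

/-- The comparison with the dual of the category of finite types. -/
def toFin : @Functor FinDual.{u} cat.{v, u} FintypeCat.{0}ᵒᵖ _ where
  obj A := Opposite.op (FintypeCat.of (Fin A.n))
  map f := Quiver.Hom.op (FintypeCat.homMk f.down)

instance : toFin.{v, u}.Full where
  map_surjective f := ⟨⟨fun x => f.unop x⟩, rfl⟩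

instance : toFin.{v, u}.Faithful where
  map_injective h := by
    apply ULift.down_injective
    funext x
    exact congrArg (fun t => t.unop x) h

instance : toFin.{v, u}.EssSurj where
  mem_essImage X := by
    let _ := Fintype.ofFinite X.unop
    exact ⟨⟨Fintype.card X.unop⟩,
      ⟨(FintypeCat.equivEquivIso (Fintype.equivFin X.unop)).op⟩⟩

instance : toFin.{v, u}.IsEquivalence where

instance : @HasFiniteLimits FinDual.{u} cat.{v, u} where
  out J _ _ := Adjunction.hasLimitsOfShape_of_equivalence toFin.{v, u}

end FinDual

/-- For a set `S` of non-pointed matrices, every finitely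
complete category with `S`-closed relations is a preorder if and only if
every finitely complete category with `S`-closed strong relations is a
preorder. -/
theorem trivial_iff_weakly_trivial (S : Set Matr) :
    (∀ (C : Type u) [Category.{v} C] [HasFiniteLimits C],
        Matr.HasSClosedRels S C (MorphismProperty.monomorphisms C) →
        ∀ X Y : C, Subsingleton (X ⟶ Y)) ↔
    (∀ (C : Type u) [Category.{v} C] [HasFiniteLimits C],
        Matr.HasSClosedRels S C (strongMonos C) →
        ∀ X Y : C, Subsingleton (X ⟶ Y)) := by
  constructor
  · intro h
    by_cases hS : ∀ M ∈ S, M.Consistent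
    · have := h FinDual.{u} (fun M hM =>
        M.closed_of_consistent (hS M hM) (fun A => Fin A.n) FinDual.homFun.{v, u}
          (fun _ _ => rfl) ⟨2⟩ 0 1 (by decide)) ⟨2⟩ ⟨2⟩
      have e := this.elim (FinDual.homFun.{v, u}.symm fun _ => 0)
        (FinDual.homFun.{v, u}.symm fun _ => 1)
      have e' := congrFun (FinDual.homFun.{v, u}.symm.injective e) 0
      exact absurd e' (by decide)
    · push Not at hS
      obtain ⟨M, hM, hcon⟩ := hS
      intro C _ _ hC
      exact M.preorder_of_not_consistent hcon C (hC M hM)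
  · intro h C _ _ hC
    refine h C (fun M hM X P R pr hP r hr => hC M hM X P R pr hP r ?_)
    have : StrongMono r := hr
    exact (inferInstance : Mono r)
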